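/- (Perturbed DEIM error bound with two canonical angles.) Let W, Ŵ, S, Ŝ ∈ ℝ^{n×r} all have orthonormal columns, assume SᵀW and ŜᵀŴ are invertible, and define D = W(SᵀW)⁻¹Sᵀ and D̂ = Ŵ(ŜᵀŴ)⁻¹Ŝᵀ. Assume D ≠ 0, D ≠ I, D̂ ≠ 0, and D̂ ≠ I. Let sin θ_max := ‖(I − ŴŴᵀ)WWᵀ‖₂ and sin ψ_max := ‖(I − SSᵀ)ŜŜᵀ‖₂. Then for every f ∈ ℝⁿ, ‖f − D̂ f‖₂ ≤ ‖D‖₂ ‖(I − WWᵀ)f‖₂ + ‖D‖₂ ‖D̂‖₂ ( sin ψ_max · ‖(I − WWᵀ)f‖₂ + sin θ_max · ‖SSᵀ f‖₂ ). -/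

import Mathlib

open Matrix

/-- Spectral norm (operator norm induced by Euclidean vector norms). -/
noncomputable def spec {m n : ℕ} (M : Matrix (Fin m) (Fin n) ℝ) : ℝ :=
  ‖LinearMap.toContinuousLinearMap (Matrix.toEuclideanLin M)‖

/-- Euclidean norm of a vector. -/
noncomputable def enorm2 {n : ℕ} (v : Fin n → ℝ) : ℝ :=
  Real.sqrt (∑ i, v i ^ 2)


lemma enorm2_eq_norm {n : ℕ} (v : Fin n → ℝ) : enorm2 v = ‖WithLp.toLp 2 v‖ := by
  simp [enorm2, EuclideanSpace.norm_eq]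

lemma enorm2_nonneg' {n : ℕ} (v : Fin n → ℝ) : 0 ≤ enorm2 v := Real.sqrt_nonneg _

lemma spec_nonneg {m n : ℕ} (M : Matrix (Fin m) (Fin n) ℝ) : 0 ≤ spec M := norm_nonneg _

lemma enorm2_mulVec_le {m n : ℕ} (M : Matrix (Fin m) (Fin n) ℝ) (v : Fin n → ℝ) :
    enorm2 (M.mulVec v) ≤ spec M * enorm2 v := by
  rw [enorm2_eq_norm, enorm2_eq_norm]
  exact (LinearMap.toContinuousLinearMap (Matrix.toEuclideanLin M)).le_opNorm (WithLp.toLp 2 v)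

lemma spec_le_of {m n : ℕ} (M : Matrix (Fin m) (Fin n) ℝ) (c : ℝ) (hc : 0 ≤ c)
    (h : ∀ v, enorm2 (M.mulVec v) ≤ c * enorm2 v) : spec M ≤ c := by
  refine ContinuousLinearMap.opNorm_le_bound _ hc fun x => ?_
  have := h x.ofLp
  rw [enorm2_eq_norm, enorm2_eq_norm] at this
  exact this

open scoped Matrix.Norms.L2Operator in
lemma spec_transpose {m n : ℕ} (M : Matrix (Fin m) (Fin n) ℝ) : spec Mᵀ = spec M := by
  have h1 : ∀ {m n : ℕ} (M : Matrix (Fin m) (Fin n) ℝ), spec M = ‖M‖ := fun M => rfl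
  rw [h1, h1, ← Matrix.l2_opNorm_conjTranspose M, Matrix.conjTranspose_eq_transpose_of_trivial]

lemma enorm2_add_le {n : ℕ} (v w : Fin n → ℝ) : enorm2 (v + w) ≤ enorm2 v + enorm2 w := by
  simp only [enorm2_eq_norm, WithLp.toLp_add]
  exact norm_add_le _ _

lemma enorm2_sub_le {n : ℕ} (v w : Fin n → ℝ) : enorm2 (v - w) ≤ enorm2 v + enorm2 w := by
  simp only [enorm2_eq_norm, WithLp.toLp_sub]
  exact norm_sub_le _ _

lemma enorm2_smul' {n : ℕ} (a : ℝ) (v : Fin n → ℝ) : enorm2 (a • v) = |a| * enorm2 v := by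
  simp only [enorm2_eq_norm, WithLp.toLp_smul, norm_smul, Real.norm_eq_abs]

lemma enorm2_swap {n : ℕ} (u v : Fin n → ℝ) (hu : enorm2 u ≠ 0) (hv : enorm2 v ≠ 0) :
    enorm2 ((enorm2 v / enorm2 u) • u + (enorm2 u / enorm2 v) • v) = enorm2 (u + v) := by
  have h : enorm2 ((enorm2 v / enorm2 u) • u + (enorm2 u / enorm2 v) • v) ^ 2
      = enorm2 (u + v) ^ 2 := by
    simp only [enorm2_eq_norm, WithLp.toLp_smul, WithLp.toLp_add] at *
    rw [norm_add_sq_real, norm_add_sq_real, norm_smul, norm_smul, real_inner_smul_left,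
      real_inner_smul_right]
    simp only [norm_div, norm_norm]
    field_simp
    ring
  exact (sq_eq_sq₀ (enorm2_nonneg' _) (enorm2_nonneg' _)).1 h

lemma enorm2_eq_zero' {n : ℕ} (v : Fin n → ℝ) : enorm2 v = 0 ↔ v = 0 := by
  rw [enorm2_eq_norm]; simp

lemma one_le_spec {n : ℕ} (D : Matrix (Fin n) (Fin n) ℝ) (hD : D * D = D) (h0 : D ≠ 0) :
    1 ≤ spec D := by
  obtain ⟨x, hx⟩ : ∃ x, D.mulVec x ≠ 0 := by
    by_contra! h
    exact h0 (Matrix.ext_of_mulVec_single fun i => by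
      rw [h, Matrix.zero_mulVec])
  have h := enorm2_mulVec_le D (D.mulVec x)
  rw [Matrix.mulVec_mulVec, hD] at h
  have hp : 0 < enorm2 (D.mulVec x) :=
    lt_of_le_of_ne (enorm2_nonneg' _) fun h => hx ((enorm2_eq_zero' _).1 h.symm)
  exact (le_mul_iff_one_le_left hp).1 h

lemma spec_one_sub_le {n : ℕ} (D : Matrix (Fin n) (Fin n) ℝ) (hD : D * D = D) (h0 : D ≠ 0) :
    spec (1 - D) ≤ spec D := by
  refine spec_le_of _ _ (spec_nonneg _) fun x => ?_
  have h1 := one_le_spec D hD h0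
  obtain ⟨u, hu⟩ : ∃ u, u = D.mulVec x := ⟨_, rfl⟩
  obtain ⟨v, hv⟩ : ∃ v, v = (1 - D).mulVec x := ⟨_, rfl⟩
  have hx : x = u + v := by rw [hu, hv, Matrix.sub_mulVec, Matrix.one_mulVec]; abel
  have hDu : D.mulVec u = u := by rw [hu, Matrix.mulVec_mulVec, hD]
  have hDv : D.mulVec v = 0 := by
    rw [hv, Matrix.mulVec_mulVec, mul_sub, mul_one, hD, sub_self, Matrix.zero_mulVec]
  rw [← hv]
  by_cases hv0 : enorm2 v = 0
  · rw [hv0]; exact mul_nonneg (spec_nonneg _) (enorm2_nonneg' _)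
  by_cases hu0 : enorm2 u = 0
  · rw [(enorm2_eq_zero' _).1 hu0, zero_add] at hx
    rw [hx]
    exact le_mul_of_one_le_left (enorm2_nonneg' _) h1
  have h := enorm2_mulVec_le D ((enorm2 v / enorm2 u) • u + (enorm2 u / enorm2 v) • v)
  rw [enorm2_swap u v hu0 hv0, Matrix.mulVec_add, Matrix.mulVec_smul, Matrix.mulVec_smul,
    hDu, hDv, smul_zero, add_zero, enorm2_smul', abs_of_nonneg
    (div_nonneg (enorm2_nonneg' _) (enorm2_nonneg' _)), div_mul_cancel₀ _ hu0, ← hx] at h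
  exact h

lemma deim_facts {n r : ℕ} (W S : Matrix (Fin n) (Fin r) ℝ)
    (hW : Wᵀ * W = 1) (hS : Sᵀ * S = 1) (hInv : IsUnit (Sᵀ * W))
    (D : Matrix (Fin n) (Fin n) ℝ) (hD : D = W * (Sᵀ * W)⁻¹ * Sᵀ) :
    D * W = W ∧ Sᵀ * D = Sᵀ ∧ D * D = D ∧ (W * Wᵀ) * D = D ∧ D * (S * Sᵀ) = D := by
  have hdet := (Matrix.isUnit_iff_isUnit_det _).1 hInv
  have a : D * W = W := by
    rw [hD, Matrix.mul_assoc, Matrix.mul_assoc, Matrix.nonsing_inv_mul _ hdet, Matrix.mul_one]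
  have b : Sᵀ * D = Sᵀ := by
    rw [hD, ← Matrix.mul_assoc, ← Matrix.mul_assoc, Matrix.mul_nonsing_inv _ hdet, Matrix.one_mul]
  refine ⟨a, b, ?_, ?_, ?_⟩
  · nth_rw 2 [hD]
    rw [← Matrix.mul_assoc, ← Matrix.mul_assoc, a, ← hD]
  · rw [hD, Matrix.mul_assoc W Wᵀ, ← Matrix.mul_assoc Wᵀ, ← Matrix.mul_assoc Wᵀ, hW,
      Matrix.one_mul, ← Matrix.mul_assoc]
  · rw [hD, Matrix.mul_assoc _ Sᵀ, ← Matrix.mul_assoc Sᵀ, hS, Matrix.one_mul]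

/-- perturbed DEIM error bound with two canonical angles:
    `‖f − D̂ f‖₂ ≤ ‖D‖₂‖(I−WWᵀ)f‖₂ + ‖D‖₂‖D̂‖₂ (sin ψ_max ‖(I−WWᵀ)f‖₂ + sin θ_max ‖SSᵀ f‖₂)`. -/
theorem perturbed_deim_two_angle_bound {n r : ℕ}
    (W What S Shat : Matrix (Fin n) (Fin r) ℝ)
    (hW : Wᵀ * W = 1) (hWhat : Whatᵀ * What = 1)
    (hS : Sᵀ * S = 1) (hShat : Shatᵀ * Shat = 1)
    (hInv : IsUnit (Sᵀ * W)) (hInvHat : IsUnit (Shatᵀ * What))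
    (D Dhat : Matrix (Fin n) (Fin n) ℝ)
    (hD : D = W * (Sᵀ * W)⁻¹ * Sᵀ)
    (hDhat : Dhat = What * (Shatᵀ * What)⁻¹ * Shatᵀ)
    (hD0 : D ≠ 0) (hD1 : D ≠ 1) (hDhat0 : Dhat ≠ 0) (hDhat1 : Dhat ≠ 1)
    (sinθ : ℝ) (hsinθ : sinθ = spec ((1 - What * Whatᵀ) * (W * Wᵀ)))
    (sinψ : ℝ) (hsinψ : sinψ = spec ((1 - S * Sᵀ) * (Shat * Shatᵀ))) :
    ∀ f : Fin n → ℝ,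
      enorm2 (f - Dhat.mulVec f) ≤
        spec D * enorm2 ((1 - W * Wᵀ).mulVec f) +
          spec D * spec Dhat *
            (sinψ * enorm2 ((1 - W * Wᵀ).mulVec f) +
              sinθ * enorm2 ((S * Sᵀ).mulVec f)) := by
  intro f
  obtain ⟨a1, a2, a3, a4, a5⟩ := deim_facts W S hW hS hInv D hD
  obtain ⟨b1, b2, b3, b4, b5⟩ := deim_facts What Shat hWhat hShat hInvHat Dhat hDhat
  have n1 := spec_one_sub_le D a3 hD0
  have n2 := spec_one_sub_le Dhat b3 hDhat0
  have hψ : sinψ = spec ((Shat * Shatᵀ) * (1 - S * Sᵀ)) := by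
    rw [hsinψ, ← spec_transpose]
    simp [Matrix.transpose_mul, Matrix.transpose_sub]
  have hψ0 : 0 ≤ sinψ := hψ ▸ spec_nonneg _
  have hθ0 : 0 ≤ sinθ := hsinθ ▸ spec_nonneg _
  have e1 : (1 - D) * (1 - W * Wᵀ) = 1 - D := by
    have : D * (W * Wᵀ) = W * Wᵀ := by rw [← Matrix.mul_assoc, a1]
    rw [sub_mul, mul_sub, mul_sub, this]; simp
  have e2 : (1 - Dhat) * ((1 - What * Whatᵀ) * (W * Wᵀ)) * D * (S * Sᵀ) = (1 - Dhat) * D := by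
    have : Dhat * (What * Whatᵀ) = What * Whatᵀ := by rw [← Matrix.mul_assoc, b1]
    have h' : (1 - Dhat) * (1 - What * Whatᵀ) = 1 - Dhat := by
      rw [sub_mul, mul_sub, mul_sub, this]; simp
    rw [← mul_assoc (1 - Dhat), h', mul_assoc, mul_assoc, a5, a4]
  have e3 : Dhat * ((Shat * Shatᵀ) * (1 - S * Sᵀ)) * (1 - D) = Dhat * (1 - D) := by
    have : S * Sᵀ * D = S * Sᵀ := by rw [Matrix.mul_assoc, a2]
    have h' : (1 - S * Sᵀ) * (1 - D) = 1 - D := by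
      rw [mul_sub, sub_mul, sub_mul, this]; simp
    rw [← mul_assoc, b5, mul_assoc, h']
  set g := (1 - W * Wᵀ).mulVec f with hg
  set p := (S * Sᵀ).mulVec f with hp
  have hgn := enorm2_nonneg' g
  have hpn := enorm2_nonneg' p
  have k1 : (1 - D).mulVec f = (1 - D).mulVec g := by rw [hg, Matrix.mulVec_mulVec, e1]
  have B1 : enorm2 ((1 - D).mulVec f) ≤ spec D * enorm2 g := by
    rw [k1]
    exact (enorm2_mulVec_le _ _).trans (mul_le_mul_of_nonneg_right n1 hgn)
  have B2 : enorm2 (((1 - Dhat) * D).mulVec f) ≤ spec Dhat * (sinθ * (spec D * enorm2 p)) := by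
    rw [← e2, ← Matrix.mulVec_mulVec, ← Matrix.mulVec_mulVec, ← Matrix.mulVec_mulVec, ← hp]
    refine (enorm2_mulVec_le _ _).trans (mul_le_mul n2 ?_ (enorm2_nonneg' _) (spec_nonneg _))
    refine (enorm2_mulVec_le _ _).trans ?_
    rw [← hsinθ]
    exact mul_le_mul_of_nonneg_left (enorm2_mulVec_le _ _) hθ0
  have B3 : enorm2 ((Dhat * (1 - D)).mulVec f) ≤ spec Dhat * (sinψ * (spec D * enorm2 g)) := by
    rw [← e3, ← Matrix.mulVec_mulVec, ← Matrix.mulVec_mulVec]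
    refine (enorm2_mulVec_le _ _).trans (mul_le_mul_of_nonneg_left ?_ (spec_nonneg _))
    refine (enorm2_mulVec_le _ _).trans ?_
    rw [← hψ]
    exact mul_le_mul_of_nonneg_left B1 hψ0
  have key : f - Dhat.mulVec f
      = (1 - D).mulVec f + ((1 - Dhat) * D).mulVec f - (Dhat * (1 - D)).mulVec f := by
    rw [← Matrix.add_mulVec, ← Matrix.sub_mulVec]
    have : 1 - D + (1 - Dhat) * D - Dhat * (1 - D) = 1 - Dhat := by noncomm_ring
    rw [this, Matrix.sub_mulVec, Matrix.one_mulVec]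
  rw [key]
  have t1 := enorm2_sub_le ((1 - D).mulVec f + ((1 - Dhat) * D).mulVec f)
    ((Dhat * (1 - D)).mulVec f)
  have t2 := enorm2_add_le ((1 - D).mulVec f) (((1 - Dhat) * D).mulVec f)
  linarith
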